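/- Suppose there is an identity (1 − X²)Y² + 1 = Σⱼ pⱼ(X,Y)² + (Σⱼ qⱼ(X,Y)²)·(1 − X²)³ in ℝ[X,Y] where each pⱼ, qⱼ has degree in Y at most m′ and at least one has Y-degree exactly m′ ≥ 2. Then comparing coefficients of Y^{2m′} gives 0 = Σⱼ p_{j,m′}(X)² + Σⱼ q_{j,m′}(X)²·(1 − X²)³, which forces all p_{j,m′} and q_{j,m′} to vanish identically — a contradiction. -/

import Mathlib

open Polynomial

theorem aux_zero_of_Ioo (f : Polynomial ℝ)
    (h : ∀ x ∈ Set.Ioo (-1 : ℝ) 1, f.eval x = 0) : f = 0 := by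
  apply Polynomial.eq_zero_of_infinite_isRoot
  exact (Set.Ioo_infinite (by norm_num : (-1 : ℝ) < 1)).mono (fun x hx => h x hx)

theorem aux_coeff (m : ℕ) (p : Polynomial (Polynomial ℝ)) (hp : p.natDegree ≤ m) :
    (p ^ 2).coeff (2 * m) = (p.coeff m) ^ 2 := by
  have := Polynomial.coeff_pow_of_natDegree_le (m := 2) hp
  first
    | exact this
    | rw [mul_comm]; exact this

/-- In `(ℝ[X])[Y]` there is no identity
`(1 − X²)Y² + 1 = Σⱼ pⱼ² + (Σⱼ qⱼ²)·(1 − X²)³` in which all `pⱼ, qⱼ` have `Y`-degree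
at most `m′ ≥ 2` and some coefficient of `Y^{m′}` among them is nonzero. -/
theorem stmt_18 :
    ¬ ∃ (m' : ℕ) (_ : 2 ≤ m') (s₁ s₂ : ℕ)
        (p : Fin s₁ → Polynomial (Polynomial ℝ))
        (q : Fin s₂ → Polynomial (Polynomial ℝ)),
      (∀ j, (p j).natDegree ≤ m') ∧ (∀ j, (q j).natDegree ≤ m') ∧
      ((∃ j, (p j).coeff m' ≠ 0) ∨ (∃ j, (q j).coeff m' ≠ 0)) ∧
      C ((1 : Polynomial ℝ) - X ^ 2) * X ^ 2 + 1 =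
        (∑ j, (p j) ^ 2) + (∑ j, (q j) ^ 2) * C (((1 : Polynomial ℝ) - X ^ 2) ^ 3) := by
  rintro ⟨m, hm, s₁, s₂, p, q, hp, hq, hne, heq⟩
  have hc := congrArg (fun f => f.coeff (2 * m)) heq
  have hL : (C ((1 : Polynomial ℝ) - X ^ 2) * X ^ 2 + 1 :
      Polynomial (Polynomial ℝ)).coeff (2 * m) = 0 := by
    rw [coeff_add, coeff_C_mul, coeff_X_pow, coeff_one, if_neg (by omega), if_neg (by omega)]
    simp
  simp only [hL] at hc
  rw [coeff_add, coeff_mul_C, finsetSum_coeff, finsetSum_coeff,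
    Finset.sum_congr rfl (fun j _ => aux_coeff m (p j) (hp j)),
    Finset.sum_congr rfl (fun j _ => aux_coeff m (q j) (hq j))] at hc
  have key : ∀ x ∈ Set.Ioo (-1 : ℝ) 1,
      (∀ j, ((p j).coeff m).eval x = 0) ∧ (∀ j, ((q j).coeff m).eval x = 0) := by
    intro x hx
    have hw : 0 < (1 - x ^ 2) ^ 3 := by
      have : 0 < 1 - x ^ 2 := by nlinarith [hx.1, hx.2]
      positivity
    have he := congrArg (Polynomial.eval x) hc
    simp only [eval_zero, eval_add, eval_mul, eval_finsetSum, eval_pow, eval_sub, eval_one,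
      eval_X] at he
    have hA : 0 ≤ ∑ j, (((p j).coeff m).eval x) ^ 2 := Finset.sum_nonneg (fun j _ => sq_nonneg _)
    have hB : 0 ≤ ∑ j, (((q j).coeff m).eval x) ^ 2 := Finset.sum_nonneg (fun j _ => sq_nonneg _)
    have hBw := mul_nonneg hB hw.le
    have hA0 : ∑ j, (((p j).coeff m).eval x) ^ 2 = 0 := by linarith
    have hB0 : ∑ j, (((q j).coeff m).eval x) ^ 2 = 0 := by
      have : (∑ j, (((q j).coeff m).eval x) ^ 2) * (1 - x ^ 2) ^ 3 = 0 := by linarith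
      exact (mul_eq_zero.mp this).resolve_right hw.ne'
    rw [Finset.sum_eq_zero_iff_of_nonneg (fun j _ => sq_nonneg _)] at hA0 hB0
    exact ⟨fun j => pow_eq_zero_iff (two_ne_zero) |>.mp (hA0 j (Finset.mem_univ j)),
      fun j => pow_eq_zero_iff (two_ne_zero) |>.mp (hB0 j (Finset.mem_univ j))⟩
  rcases hne with ⟨j, hj⟩ | ⟨j, hj⟩
  · exact hj (aux_zero_of_Ioo _ (fun x hx => (key x hx).1 j))
  · exact hj (aux_zero_of_Ioo _ (fun x hx => (key x hx).2 j))
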